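/- Let M be a special matching of a Bruhat interval [u,w] in a Weyl group W, and let x, y ∈ [u,w] be such that x⁻¹y ∈ T (i.e., {x,y} is an edge of the Bruhat graph). Then M(x)⁻¹M(y) ∈ T. -/

import Mathlib

namespace Paper

/-! ### Bruhat order on a Coxeter group -/

variable {B W : Type*} [Group W] {M : CoxeterMatrix B}

/-- One step in the Bruhat order: multiply on the left by a reflection,
increasing the length. -/
def BruhatStep (cs : CoxeterSystem M W) (a b : W) : Prop :=
  ∃ t : W, cs.IsReflection t ∧ b = t * a ∧ cs.length a < cs.length b

/-- The Bruhat order on a Coxeter group. -/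
def BruhatLE (cs : CoxeterSystem M W) : W → W → Prop :=
  Relation.ReflTransGen (BruhatStep cs)

theorem BruhatLE.length_le {cs : CoxeterSystem M W} {a b : W} (h : BruhatLE cs a b) :
    cs.length a ≤ cs.length b := by
  induction h with
  | refl => exact le_rfl
  | tail _ h ih => obtain ⟨t, -, -, hlt⟩ := h; exact ih.trans hlt.le

theorem BruhatLE.length_lt {cs : CoxeterSystem M W} {a b : W} (h : BruhatLE cs a b)
    (hne : a ≠ b) : cs.length a < cs.length b := by
  rcases Relation.ReflTransGen.cases_head h with h' | ⟨c, hc, h'⟩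
  · exact absurd h' hne
  · obtain ⟨t, -, -, hlt⟩ := hc
    exact lt_of_lt_of_le hlt (BruhatLE.length_le h')

theorem BruhatLE.antisymm {cs : CoxeterSystem M W} {a b : W} (h1 : BruhatLE cs a b)
    (h2 : BruhatLE cs b a) : a = b := by
  by_contra hne
  exact absurd (BruhatLE.length_lt h1 hne) (not_lt.mpr (BruhatLE.length_le h2))

/-- The Bruhat interval `[u,w]`, as a type. -/
abbrev BruhatInterval (cs : CoxeterSystem M W) (u w : W) : Type _ :=
  {y : W // BruhatLE cs u y ∧ BruhatLE cs y w}

/-- The Bruhat interval `[u,w]` is a poset under the Bruhat order. -/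
instance (cs : CoxeterSystem M W) (u w : W) : PartialOrder (BruhatInterval cs u w) where
  le a b := BruhatLE cs a.1 b.1
  le_refl _ := Relation.ReflTransGen.refl
  le_trans _ _ _ := Relation.ReflTransGen.trans
  le_antisymm _ _ h1 h2 := Subtype.ext (BruhatLE.antisymm h1 h2)

/-- A principal order ideal `{v : v ≤ x}` of the Bruhat order, as a type. -/
abbrev BruhatIdeal (cs : CoxeterSystem M W) (x : W) : Type _ :=
  {v : W // BruhatLE cs v x}

/-- A principal order ideal of the Bruhat order is a poset under the Bruhat order. -/
instance (cs : CoxeterSystem M W) (x : W) : PartialOrder (BruhatIdeal cs x) where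
  le a b := BruhatLE cs a.1 b.1
  le_refl _ := Relation.ReflTransGen.refl
  le_trans _ _ _ := Relation.ReflTransGen.trans
  le_antisymm _ _ h1 h2 := Subtype.ext (BruhatLE.antisymm h1 h2)

/-! ### Posets: matchings, special matchings and zircons -/

/-- A matching of a poset: an involution matching each element with an element
covering it or covered by it. -/
def IsMatching {α : Type*} [PartialOrder α] (f : α → α) : Prop :=
  Function.Involutive f ∧ ∀ x : α, f x ⋖ x ∨ x ⋖ f x

/-- A special matching of a poset. -/
def IsSpecialMatching {α : Type*} [PartialOrder α] (f : α → α) : Prop :=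
  IsMatching f ∧ ∀ x y : α, x ⋖ y → f x = y ∨ f x < f y

/-- A zircon: a poset in which the principal order ideal of every non-minimal element is
finite and has a special matching. -/
def IsZircon (α : Type*) [PartialOrder α] : Prop :=
  ∀ x : α, (∃ y : α, y < x) →
    ({v : α | v ≤ x}.Finite ∧
      ∃ f : {v : α // v ≤ x} → {v : α // v ≤ x}, IsSpecialMatching f)

/-- The degree of `v` in the Bruhat graph of the interval `[u,w]`: the number of `y ∈ [u,w]`
such that `v⁻¹ * y` is a reflection. -/
noncomputable def bruhatDeg (cs : CoxeterSystem M W) (u w v : W) : ℕ :=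
  Nat.card {y : W // (BruhatLE cs u y ∧ BruhatLE cs y w) ∧ cs.IsReflection (v⁻¹ * y)}

/-- A Bruhat interval `[u,w]` is rationally smooth if `deg_{y,w}(y) = ℓ(w) - ℓ(y)` for all
`y ∈ [u,w]` (Carrell–Peterson). -/
def RationallySmooth (cs : CoxeterSystem M W) (u w : W) : Prop :=
  ∀ y : W, BruhatLE cs u y → BruhatLE cs y w →
    bruhatDeg cs y w y = cs.length w - cs.length y

/-! ### The geometric representation -/

/-- The symmetric bilinear form on the real vector space with basis `B` attached to a Coxeter
matrix. -/
noncomputable def coxeterForm {B : Type*} (M : CoxeterMatrix B) :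
    (B →₀ ℝ) →ₗ[ℝ] (B →₀ ℝ) →ₗ[ℝ] ℝ :=
  Finsupp.linearCombination ℝ fun i =>
    Finsupp.linearCombination ℝ fun j => -Real.cos (Real.pi / M i j)

theorem coxeterForm_single {B : Type*} (M : CoxeterMatrix B) (i j : B) :
    coxeterForm M (Finsupp.single i 1) (Finsupp.single j 1) = -Real.cos (Real.pi / M i j) := by
  simp [coxeterForm]

theorem coxeterForm_single_self {B : Type*} (M : CoxeterMatrix B) (i : B) :
    coxeterForm M (Finsupp.single i 1) (Finsupp.single i 1) = 1 := by
  simp [coxeterForm_single]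

theorem coxeterForm_comm {B : Type*} (M : CoxeterMatrix B) (v w : B →₀ ℝ) :
    coxeterForm M v w = coxeterForm M w v := by
  have h : coxeterForm M = (coxeterForm M).flip := by
    ext i j
    simp [coxeterForm, M.symmetric i j]
  exact congrArg (fun F => F v w) h

/-- The orthogonal reflection in a vector of norm one. -/
noncomputable def orthReflection {V : Type*} [AddCommGroup V] [Module ℝ V]
    (F : V →ₗ[ℝ] V →ₗ[ℝ] ℝ) (α : V) : V →ₗ[ℝ] V :=
  LinearMap.id - (2 • F.flip α).smulRight α

theorem orthReflection_apply {V : Type*} [AddCommGroup V] [Module ℝ V]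
    (F : V →ₗ[ℝ] V →ₗ[ℝ] ℝ) (α v : V) :
    orthReflection F α v = v - (2 * F v α) • α := by
  simp [orthReflection]

theorem orthReflection_orthReflection {V : Type*} [AddCommGroup V] [Module ℝ V]
    (F : V →ₗ[ℝ] V →ₗ[ℝ] ℝ) {α : V} (h : F α α = 1) (v : V) :
    orthReflection F α (orthReflection F α v) = v := by
  simp only [orthReflection_apply, map_sub, map_smul, h]
  module

theorem form_orthReflection {V : Type*} [AddCommGroup V] [Module ℝ V]
    (F : V →ₗ[ℝ] V →ₗ[ℝ] ℝ) (hF : ∀ v w, F v w = F w v) {α : V} (h : F α α = 1) (v w : V) :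
    F (orthReflection F α v) (orthReflection F α w) = F v w := by
  simp only [orthReflection_apply, map_sub, map_smul, LinearMap.sub_apply, LinearMap.smul_apply, h,
    smul_eq_mul, hF α w]
  ring

/-- A product of two reflections satisfies a cubic equation determined by the angle between the
roots. -/
theorem orthReflection_mul_cubic {V : Type*} [AddCommGroup V] [Module ℝ V]
    (F : V →ₗ[ℝ] V →ₗ[ℝ] ℝ) (hF : ∀ v w, F v w = F w v) {α β : V} (hα : F α α = 1)
    (hβ : F β β = 1) (R : Module.End ℝ V)
    (hR : R = (orthReflection F α : Module.End ℝ V) * orthReflection F β) (t : ℝ)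
    (ht : t = 4 * F α β ^ 2 - 2) (v : V) :
    R (R (R v)) = (t + 1) • R (R v) - (t + 1) • R v + v := by
  subst hR ht
  simp only [Module.End.mul_apply, orthReflection_apply, map_sub, map_smul,
    hα, hβ, hF β α]
  module

theorem isLiftable_orthReflection {B : Type*} (M : CoxeterMatrix B)
    (hcrys : ∀ i j : B, i ≠ j → M i j ∈ ({2, 3, 4, 6} : Set ℕ)) :
    M.IsLiftable (fun i =>
      (orthReflection (coxeterForm M) (Finsupp.single i 1) : Module.End ℝ (B →₀ ℝ))) := by
  intro i j
  have hi := coxeterForm_single_self M i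
  have hj := coxeterForm_single_self M j
  have hij := coxeterForm_single M i j
  have hji := coxeterForm_comm M (Finsupp.single j 1) (Finsupp.single i 1)
  generalize hR : (orthReflection (coxeterForm M) (Finsupp.single i 1) : Module.End ℝ (B →₀ ℝ)) *
    orthReflection (coxeterForm M) (Finsupp.single j 1) = R
  have key := orthReflection_mul_cubic (coxeterForm M) (coxeterForm_comm M) hi hj R hR.symm
  rcases eq_or_ne i j with rfl | hne
  · rw [M.diagonal, pow_one, ← hR]
    ext1 k
    ext1
    simp only [LinearMap.comp_apply, Module.End.mul_apply,
      orthReflection_orthReflection (coxeterForm M) hi, Module.End.one_apply]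
  · have hm := hcrys i j hne
    simp only [Set.mem_insert_iff, Set.mem_singleton_iff] at hm
    rcases hm with h | h | h | h <;> rw [h] at hij ⊢
    · have h0 : coxeterForm M (Finsupp.single i 1) (Finsupp.single j 1) = 0 := by
        rw [hij]; simp
      rw [← hR, pow_two]
      refine LinearMap.ext fun v => ?_
      simp only [Module.End.mul_apply, orthReflection_apply, map_sub, map_smul,
        hi, hj, hji, h0,
        Module.End.one_apply]
      module
    · have h0 : (-1 : ℝ) = 4 * coxeterForm M (Finsupp.single i 1) (Finsupp.single j 1) ^ 2 - 2 := by
        rw [hij]; norm_num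
      refine LinearMap.ext fun v => ?_
      have := key _ h0 v
      simp only [pow_succ, pow_zero, Module.End.mul_apply, Module.End.one_apply, this]
      module
    · have h0 : (0 : ℝ) = 4 * coxeterForm M (Finsupp.single i 1) (Finsupp.single j 1) ^ 2 - 2 := by
        rw [hij]; push_cast; rw [Real.cos_pi_div_four]; ring_nf; norm_num
      refine LinearMap.ext fun v => ?_
      simp only [pow_succ, pow_zero, Module.End.mul_apply, Module.End.one_apply, key _ h0, map_add,
        map_sub, map_smul]
      module
    · have h0 : (1 : ℝ) = 4 * coxeterForm M (Finsupp.single i 1) (Finsupp.single j 1) ^ 2 - 2 := by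
        rw [hij]; push_cast; rw [Real.cos_pi_div_six]; ring_nf; norm_num
      refine LinearMap.ext fun v => ?_
      simp only [pow_succ, pow_zero, Module.End.mul_apply, Module.End.one_apply, key _ h0, map_add,
        map_sub, map_smul]
      module

/-- The geometric representation of a Coxeter group. -/
noncomputable def geomRep {B W : Type*} [Group W] {M : CoxeterMatrix B} (cs : CoxeterSystem M W)
    (hcrys : ∀ i j : B, i ≠ j → M i j ∈ ({2, 3, 4, 6} : Set ℕ)) :
    W →* Module.End ℝ (B →₀ ℝ) :=
  cs.lift ⟨_, isLiftable_orthReflection M hcrys⟩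

section GeomRep

variable {B W : Type*} [Group W] {M : CoxeterMatrix B} (cs : CoxeterSystem M W)
  (hcrys : ∀ i j : B, i ≠ j → M i j ∈ ({2, 3, 4, 6} : Set ℕ))

theorem geomRep_simple (i : B) (v : B →₀ ℝ) :
    geomRep cs hcrys (cs.simple i) v =
      v - (2 * coxeterForm M v (Finsupp.single i 1)) • Finsupp.single i 1 := by
  rw [geomRep, cs.lift_apply_simple, orthReflection_apply]

theorem geomRep_simple_self (i : B) :
    geomRep cs hcrys (cs.simple i) (Finsupp.single i 1) = -Finsupp.single i 1 := by
  rw [geomRep_simple, coxeterForm_single_self]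
  module

theorem coxeterForm_geomRep (w : W) (x y : B →₀ ℝ) :
    coxeterForm M (geomRep cs hcrys w x) (geomRep cs hcrys w y) = coxeterForm M x y := by
  induction w using cs.simple_induction_left generalizing x y with
  | one => simp
  | mul_simple_left w i ih =>
    simp only [map_mul, Module.End.mul_apply]
    rw [geomRep, cs.lift_apply_simple, form_orthReflection _ (coxeterForm_comm M)
      (coxeterForm_single_self M i)]
    exact ih x y

theorem geomRep_apply_inv_self (w : W) (v : B →₀ ℝ) :
    geomRep cs hcrys w (geomRep cs hcrys w⁻¹ v) = v := by
  rw [← Module.End.mul_apply, ← map_mul]; simp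

/-- The coefficients of the roots of a dihedral group in terms of its simple roots. -/
noncomputable def dihedralCoeff (d : ℝ) : ℕ → ℝ
  | 0 => 0
  | 1 => 1
  | n + 2 => d * dihedralCoeff d (n + 1) - dihedralCoeff d n

theorem dihedralCoeff_nonneg {m : ℕ} (hm : m ∈ ({2, 3, 4, 6} : Set ℕ)) {k : ℕ} (hk : k ≤ m) :
    0 ≤ dihedralCoeff (2 * Real.cos (Real.pi / m)) k := by
  simp only [Set.mem_insert_iff, Set.mem_singleton_iff] at hm
  have h2 := Real.sq_sqrt (show (0 : ℝ) ≤ 2 by norm_num)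
  have h3 := Real.sq_sqrt (show (0 : ℝ) ≤ 3 by norm_num)
  have h2' := Real.sqrt_nonneg 2
  have h3' := Real.sqrt_nonneg 3
  have e3 : √2 ^ 3 = 2 * √2 := by rw [pow_succ, h2]
  have d3 : √3 ^ 3 = 3 * √3 := by rw [pow_succ, h3]
  have d4 : √3 ^ 4 = 9 := by rw [pow_succ, d3]; linear_combination 3 * h3
  have d5 : √3 ^ 5 = 9 * √3 := by rw [pow_succ, d4]
  rcases hm with rfl | rfl | rfl | rfl <;> interval_cases k <;>
    simp [dihedralCoeff] <;> linarith

theorem geomRep_alternatingWord {i j : B} (k : ℕ) :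
    geomRep cs hcrys (cs.wordProd (CoxeterSystem.alternatingWord i j k)) (Finsupp.single i 1) =
      if Even k then
        dihedralCoeff (2 * Real.cos (Real.pi / M i j)) (k + 1) • Finsupp.single i 1 +
          dihedralCoeff (2 * Real.cos (Real.pi / M i j)) k • Finsupp.single j 1
      else
        dihedralCoeff (2 * Real.cos (Real.pi / M i j)) k • Finsupp.single i 1 +
          dihedralCoeff (2 * Real.cos (Real.pi / M i j)) (k + 1) • Finsupp.single j 1 := by
  induction k with
  | zero => simp [CoxeterSystem.alternatingWord, dihedralCoeff]
  | succ k ih =>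
    rw [CoxeterSystem.alternatingWord_succ', cs.wordProd_cons, map_mul, Module.End.mul_apply, ih]
    by_cases hk : Even k
    · have hk' : ¬Even (k + 1) := by simpa [Nat.even_add_one] using hk
      simp only [hk, hk', if_true, if_false, map_add, map_smul, geomRep_simple,
        coxeterForm_single_self, coxeterForm_single, dihedralCoeff]
      module
    · have hk' : Even (k + 1) := by simpa [Nat.even_add_one] using hk
      simp only [hk, hk', if_true, if_false, map_add, map_smul, geomRep_simple,
        coxeterForm_single_self, coxeterForm_single, dihedralCoeff, M.symmetric j i]
      module

theorem geomRep_single_nonneg (w : W) (i : B) (hw : cs.length w < cs.length (w * cs.simple i))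
    (b : B) : 0 ≤ geomRep cs hcrys w (Finsupp.single i 1) b := by
  induction hn : cs.length w using Nat.strong_induction_on generalizing w i b with
  | _ n ih =>
  subst hn
  rcases eq_or_ne w 1 with rfl | hw1
  · rw [map_one, Module.End.one_apply]
    exact (Finsupp.single_nonneg.mpr zero_le_one) b
  obtain ⟨j, hj⟩ := cs.exists_rightDescent_of_ne_one hw1
  have hij : i ≠ j := by
    rintro rfl
    exact absurd hj (not_lt.mpr hw.le)
  have hj' := cs.isRightDescent_iff.mp hj
  let a : ℕ → W := fun k => w * (cs.wordProd (CoxeterSystem.alternatingWord i j k))⁻¹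
  let p : ℕ → Prop := fun k => cs.length (a k) + k = cs.length w
  have a_succ (k : ℕ) : a (k + 1) = a k * cs.simple (if Even k then j else i) := by
    simp [a, CoxeterSystem.alternatingWord_succ', cs.wordProd_cons, mul_assoc]
  have hp1 : p 1 := by simpa [p, a, CoxeterSystem.alternatingWord] using hj'
  classical
  set k := Nat.findGreatest p (cs.length w) with hk
  have hlen : 1 ≤ cs.length w := by omega
  have hk1 : 1 ≤ k := Nat.le_findGreatest hlen hp1
  have hpk : p k := Nat.findGreatest_spec hlen hp1
  have hlt : cs.length (a k) < cs.length w := by simp only [p] at hpk; omega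
  have hnext : cs.length (a k) < cs.length (a k * cs.simple (if Even k then j else i)) := by
    rcases cs.length_mul_simple (a k) (if Even k then j else i) with h | h
    · omega
    · have hps : p (k + 1) := by
        simp only [p, a_succ] at hpk ⊢
        omega
      have : k + 1 ≤ k := Nat.le_findGreatest (by simp only [p] at hps; omega) hps
      omega
  have hprev : cs.length (a k) < cs.length (a k * cs.simple (if Even k then i else j)) := by
    obtain ⟨l, hl⟩ : ∃ l, k = l + 1 := ⟨k - 1, by omega⟩
    have h1 : a k * cs.simple (if Even k then i else j) = a l := by
      rw [hl, a_succ]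
      by_cases hl : Even l
      · simp [hl, Nat.even_add_one, mul_assoc]
      · simp [hl, Nat.even_add_one, mul_assoc]
    rw [h1]
    have h2 : cs.length w ≤ cs.length (a l) + l := by
      calc cs.length w
          = cs.length (a l * cs.wordProd (CoxeterSystem.alternatingWord i j l)) := by simp [a]
        _ ≤ cs.length (a l) + cs.length (cs.wordProd (CoxeterSystem.alternatingWord i j l)) :=
            cs.length_mul_le _ _
        _ ≤ _ := by
          gcongr
          simpa using cs.length_wordProd_le (CoxeterSystem.alternatingWord i j l)
    simp only [p] at hpk
    omega
  have hi : cs.length (a k) < cs.length (a k * cs.simple i) := by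
    by_cases h : Even k
    · simpa [h] using hprev
    · simpa [h] using hnext
  have hj : cs.length (a k) < cs.length (a k * cs.simple j) := by
    by_cases h : Even k
    · simpa [h] using hnext
    · simpa [h] using hprev
  have hm := hcrys i j hij
  have hkm : k + 1 ≤ M i j := by
    by_contra hcon
    have hM0 : M j i ≠ 0 := by
      rw [M.symmetric]
      intro h0
      simp [h0] at hm
    have hnr := cs.not_isReduced_alternatingWord j i hM0 (m := k + 1)
      (by rw [M.symmetric]; omega)
    have hle := cs.length_wordProd_le (CoxeterSystem.alternatingWord j i (k + 1))
    rw [CoxeterSystem.IsReduced] at hnr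
    have heq : w * cs.simple i =
        a k * cs.wordProd (CoxeterSystem.alternatingWord j i (k + 1)) := by
      rw [CoxeterSystem.alternatingWord_succ, cs.wordProd_concat]
      simp [a, mul_assoc]
    have := cs.length_mul_le (a k) (cs.wordProd (CoxeterSystem.alternatingWord j i (k + 1)))
    rw [← heq] at this
    simp only [CoxeterSystem.length_alternatingWord, p] at *
    omega
  have hwa : w = a k * cs.wordProd (CoxeterSystem.alternatingWord i j k) := by simp [a]
  have h1 := ih _ hlt (a k) i hi b rfl
  have h2 := ih _ hlt (a k) j hj b rfl
  have c1 := dihedralCoeff_nonneg hm (k := k) (by omega)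
  have c2 := dihedralCoeff_nonneg hm hkm
  rw [hwa, map_mul, Module.End.mul_apply, geomRep_alternatingWord]
  split_ifs <;>
  · simp only [map_add, map_smul, Finsupp.add_apply, Finsupp.smul_apply, smul_eq_mul]
    positivity

end GeomRep

/-! ### Roots of reflections -/

/-- A finite-dimensional model of the reflections of a Coxeter group: every reflection `t` acts as
the orthogonal reflection in a unit vector `root t`, and the sign of the height of a root detects
how lengths change. -/
structure ReflectionModel {B W : Type*} [Group W] {M : CoxeterMatrix B} (cs : CoxeterSystem M W)
    (V : Type*) [AddCommGroup V] [Module ℝ V] where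
  /-- the action of the group -/
  act : W →* Module.End ℝ V
  /-- the invariant form -/
  form : V →ₗ[ℝ] V →ₗ[ℝ] ℝ
  /-- the height function -/
  ht : V →ₗ[ℝ] ℝ
  /-- the positive root of a reflection -/
  root : W → V
  form_comm : ∀ v w, form v w = form w v
  form_act : ∀ g v w, form (act g v) (act g w) = form v w
  form_root : ∀ {t}, cs.IsReflection t → form (root t) (root t) = 1
  act_reflection : ∀ {t}, cs.IsReflection t → ∀ v, act t v = v - (2 * form v (root t)) • root t
  ht_root : ∀ {t}, cs.IsReflection t → 0 < ht (root t)
  root_injective : ∀ {a b}, cs.IsReflection a → cs.IsReflection b → root a = root b → a = b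
  length_lt_iff : ∀ {t}, cs.IsReflection t → ∀ w,
    (cs.length w < cs.length (w * t) ↔ 0 < ht (act w (root t)))
  form_sq_lt_one : ∀ {a b}, cs.IsReflection a → cs.IsReflection b → a ≠ b →
    form (root a) (root b) ^ 2 < 1

section GeomRep

variable {B W : Type*} [Group W] {M : CoxeterMatrix B} (cs : CoxeterSystem M W)
  (hcrys : ∀ i j : B, i ≠ j → M i j ∈ ({2, 3, 4, 6} : Set ℕ))

/-- The sum of the coordinates of a vector. -/
noncomputable def coordSum (B : Type*) : (B →₀ ℝ) →ₗ[ℝ] ℝ :=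
  Finsupp.linearCombination ℝ fun _ => (1 : ℝ)

theorem coordSum_single {B : Type*} (i : B) : coordSum B (Finsupp.single i 1) = 1 := by
  simp [coordSum]

theorem coordSum_pos {B : Type*} {v : B →₀ ℝ} (hv : ∀ b, 0 ≤ v b) (h0 : v ≠ 0) :
    0 < coordSum B v := by
  simp only [coordSum, Finsupp.linearCombination_apply, smul_eq_mul, mul_one, Finsupp.sum]
  refine Finset.sum_pos (fun b hb => lt_of_le_of_ne (hv b) ?_) (Finsupp.support_nonempty_iff.mpr h0)
  exact (Finsupp.mem_support_iff.mp hb).symm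

theorem coxeterForm_geomRep_single (w : W) (i : B) :
    coxeterForm M (geomRep cs hcrys w (Finsupp.single i 1))
      (geomRep cs hcrys w (Finsupp.single i 1)) = 1 := by
  rw [coxeterForm_geomRep, coxeterForm_single_self]

theorem geomRep_single_ne_zero (w : W) (i : B) :
    geomRep cs hcrys w (Finsupp.single i 1) ≠ 0 := by
  intro h
  simpa [h] using coxeterForm_geomRep_single cs hcrys w i

theorem geomRep_mul_simple_single (w : W) (i : B) :
    geomRep cs hcrys (w * cs.simple i) (Finsupp.single i 1) =
      -geomRep cs hcrys w (Finsupp.single i 1) := by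
  rw [map_mul, Module.End.mul_apply, geomRep_simple_self, map_neg]

theorem length_lt_mul_simple_iff (w : W) (i : B) :
    cs.length w < cs.length (w * cs.simple i) ↔
      0 < coordSum B (geomRep cs hcrys w (Finsupp.single i 1)) := by
  have key (w : W) (h : cs.length w < cs.length (w * cs.simple i)) :
      0 < coordSum B (geomRep cs hcrys w (Finsupp.single i 1)) :=
    coordSum_pos (geomRep_single_nonneg cs hcrys w i h) (geomRep_single_ne_zero cs hcrys w i)
  refine ⟨key w, fun h => ?_⟩
  by_contra hlt
  have h' := key (w * cs.simple i) (by
    have := cs.length_mul_simple_ne w i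
    simp only [mul_assoc, cs.simple_mul_simple_self, mul_one]
    omega)
  rw [geomRep_mul_simple_single, map_neg] at h'
  linarith

theorem geomRep_single_nonneg_of_coordSum_pos {w : W} {i : B}
    (h : 0 < coordSum B (geomRep cs hcrys w (Finsupp.single i 1))) (b : B) :
    0 ≤ geomRep cs hcrys w (Finsupp.single i 1) b :=
  geomRep_single_nonneg cs hcrys w i ((length_lt_mul_simple_iff cs hcrys w i).mpr h) b

theorem geomRep_single_nonpos_of_coordSum_neg {w : W} {i : B}
    (h : coordSum B (geomRep cs hcrys w (Finsupp.single i 1)) < 0) (b : B) :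
    geomRep cs hcrys w (Finsupp.single i 1) b ≤ 0 := by
  have := geomRep_single_nonneg_of_coordSum_pos cs hcrys (w := w * cs.simple i) (i := i)
    (by rw [geomRep_mul_simple_single, map_neg]; linarith) b
  rw [geomRep_mul_simple_single, Finsupp.neg_apply] at this
  linarith

theorem coordSum_geomRep_single_ne_zero (w : W) (i : B) :
    coordSum B (geomRep cs hcrys w (Finsupp.single i 1)) ≠ 0 := by
  rcases cs.length_mul_simple w i with h | h
  · exact ((length_lt_mul_simple_iff cs hcrys w i).mp (by omega)).ne'
  · have := (length_lt_mul_simple_iff cs hcrys (w * cs.simple i) i).mp (by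
      simp only [mul_assoc, cs.simple_mul_simple_self, mul_one]
      omega)
    rw [geomRep_mul_simple_single, map_neg] at this
    exact (by linarith : coordSum B (geomRep cs hcrys w (Finsupp.single i 1)) < 0).ne

theorem geomRep_injective : Function.Injective (geomRep cs hcrys) := by
  rw [injective_iff_map_eq_one]
  intro w hw
  by_contra hne
  obtain ⟨i, hi⟩ := cs.exists_rightDescent_of_ne_one hne
  have := (length_lt_mul_simple_iff cs hcrys w i).mpr (by
    rw [hw, Module.End.one_apply, coordSum_single]
    exact one_pos)
  exact absurd hi (not_lt.mpr this.le)

/-- A reflection acts as the orthogonal reflection in a root. -/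
theorem geomRep_conj_simple (w : W) (i : B) (v : B →₀ ℝ) :
    geomRep cs hcrys (w * cs.simple i * w⁻¹) v =
      v - (2 * coxeterForm M v (geomRep cs hcrys w (Finsupp.single i 1))) •
        geomRep cs hcrys w (Finsupp.single i 1) := by
  rw [map_mul, map_mul, Module.End.mul_apply, Module.End.mul_apply, geomRep_simple, map_sub,
    map_smul, geomRep_apply_inv_self, ← coxeterForm_geomRep cs hcrys w, geomRep_apply_inv_self]

/-- A positive root that becomes negative under a simple reflection is a simple root. -/
theorem geomRep_single_eq_single {w : W} {i j : B}
    (h : 0 < coordSum B (geomRep cs hcrys w (Finsupp.single i 1)))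
    (h' : coordSum B (geomRep cs hcrys (cs.simple j * w) (Finsupp.single i 1)) < 0) :
    geomRep cs hcrys w (Finsupp.single i 1) = Finsupp.single j 1 := by
  have h1 := geomRep_single_nonneg_of_coordSum_pos cs hcrys h
  have h2 := geomRep_single_nonpos_of_coordSum_neg cs hcrys h'
  have h3 := coxeterForm_geomRep_single cs hcrys w i
  rw [map_mul, Module.End.mul_apply, geomRep_simple] at h2
  generalize geomRep cs hcrys w (Finsupp.single i 1) = γ at *
  have h4 : γ = γ j • Finsupp.single j 1 := by
    ext b
    rcases eq_or_ne j b with rfl | hb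
    · simp
    · have := h2 b
      rw [Finsupp.sub_apply, Finsupp.smul_apply, Finsupp.single_eq_of_ne' hb, smul_zero,
        sub_zero] at this
      rw [Finsupp.smul_apply, Finsupp.single_eq_of_ne' hb, smul_zero]
      exact le_antisymm this (h1 b)
  have h5 : γ j = 1 := by
    rw [h4] at h3
    simp only [map_smul, LinearMap.smul_apply, coxeterForm_single_self, smul_eq_mul] at h3
    have := h1 j
    nlinarith
  rw [h4, h5, one_smul]

theorem exists_conj_simple_of_isReflection {t : W} (ht : cs.IsReflection t) :
    ∃ w i, t = w * cs.simple i * w⁻¹ ∧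
      0 < coordSum B (geomRep cs hcrys w (Finsupp.single i 1)) := by
  obtain ⟨w, i, rfl⟩ := ht
  rcases lt_or_gt_of_ne (coordSum_geomRep_single_ne_zero cs hcrys w i) with h | h
  · refine ⟨w * cs.simple i, i, by simp [mul_assoc], ?_⟩
    rw [geomRep_mul_simple_single, map_neg]
    linarith
  · exact ⟨w, i, rfl, h⟩

theorem length_mul_lt_of_coordSum_neg {g : W} {i : B}
    (hg : 0 < coordSum B (geomRep cs hcrys g (Finsupp.single i 1))) (w : W)
    (hw : coordSum B (geomRep cs hcrys (w * g) (Finsupp.single i 1)) < 0) :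
    cs.length (w * (g * cs.simple i * g⁻¹)) < cs.length w := by
  induction hn : cs.length w generalizing w with
  | zero =>
    rw [cs.length_eq_zero_iff] at hn
    rw [hn, one_mul] at hw
    linarith
  | succ n ih =>
    have hne : w ≠ 1 := by
      rintro rfl
      simp at hn
    obtain ⟨j, hj⟩ := cs.exists_leftDescent_of_ne_one hne
    rw [cs.isLeftDescent_iff] at hj
    obtain ⟨w', rfl⟩ : ∃ w', w = cs.simple j * w' := ⟨cs.simple j * w, by simp⟩
    rw [cs.simple_mul_simple_cancel_left] at hj
    rcases lt_or_gt_of_ne (coordSum_geomRep_single_ne_zero cs hcrys (w' * g) i) with h | h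
    · have h1 := ih w' h (by omega)
      have h2 := cs.length_mul_le (cs.simple j) (w' * (g * cs.simple i * g⁻¹))
      rw [cs.length_simple, ← mul_assoc] at h2
      omega
    · rw [mul_assoc] at hw
      have h1 := geomRep_single_eq_single cs hcrys h hw
      have h2 : w' * (g * cs.simple i * g⁻¹) * w'⁻¹ = cs.simple j := by
        apply geomRep_injective cs hcrys
        refine LinearMap.ext fun v => ?_
        have := geomRep_conj_simple cs hcrys (w' * g) i v
        rw [h1, ← geomRep_simple cs hcrys] at this
        rw [← this]
        congr 2
        group
      have h3 : cs.simple j * w' * (g * cs.simple i * g⁻¹) = w' := by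
        rw [mul_assoc, mul_inv_eq_iff_eq_mul.mp h2, cs.simple_mul_simple_cancel_left]
      rw [h3]
      omega

theorem length_lt_mul_conj_simple_iff {g : W} {i : B}
    (hg : 0 < coordSum B (geomRep cs hcrys g (Finsupp.single i 1))) (w : W) :
    cs.length w < cs.length (w * (g * cs.simple i * g⁻¹)) ↔
      0 < coordSum B (geomRep cs hcrys w (geomRep cs hcrys g (Finsupp.single i 1))) := by
  rw [← Module.End.mul_apply, ← map_mul]
  constructor
  · intro h
    by_contra h'
    have := length_mul_lt_of_coordSum_neg cs hcrys hg w
      (lt_of_le_of_ne (not_lt.mp h') (coordSum_geomRep_single_ne_zero cs hcrys _ i))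
    omega
  · intro h
    have := length_mul_lt_of_coordSum_neg cs hcrys hg (w * (g * cs.simple i * g⁻¹)) (by
      have : w * (g * cs.simple i * g⁻¹) * g = w * g * cs.simple i := by group
      rw [this, geomRep_mul_simple_single, map_neg]
      linarith)
    simpa [mul_assoc] using this

/-- In a finite group, distinct reflections span a positive definite plane. -/
theorem coxeterForm_sq_lt_one [Finite W] {a b : W} {α β : B →₀ ℝ}
    (hα : coxeterForm M α α = 1) (hβ : coxeterForm M β β = 1)
    (ha : ∀ v, geomRep cs hcrys a v = v - (2 * coxeterForm M v α) • α)
    (hb : ∀ v, geomRep cs hcrys b v = v - (2 * coxeterForm M v β) • β)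
    (hne : α - coxeterForm M α β • β ≠ 0) : coxeterForm M α β ^ 2 < 1 := by
  classical
  cases nonempty_fintype W
  obtain ⟨i, hi⟩ := DFunLike.ne_iff.mp hne
  let p (g : W) : (B →₀ ℝ) →ₗ[ℝ] ℝ := Finsupp.lapply i ∘ₗ geomRep cs hcrys g
  let G : (B →₀ ℝ) →ₗ[ℝ] (B →₀ ℝ) →ₗ[ℝ] ℝ :=
    ∑ g : W, (LinearMap.mul ℝ ℝ).compl₁₂ (p g) (p g)
  have G_apply (v w) : G v w = ∑ g : W, p g v * p g w := by
    simp [G, LinearMap.sum_apply]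
  have G_comm (v w) : G v w = G w v := by
    simp only [G_apply, mul_comm]
  have G_inv (h : W) (v w) : G (geomRep cs hcrys h v) (geomRep cs hcrys h w) = G v w := by
    rw [G_apply, G_apply]
    refine Fintype.sum_equiv (Equiv.mulRight h) _ _ fun g => ?_
    simp [p]
  have G_pos : 0 < G (α - coxeterForm M α β • β) (α - coxeterForm M α β • β) := by
    rw [G_apply]
    refine Finset.sum_pos' (fun g _ => mul_self_nonneg _) ⟨1, Finset.mem_univ _, ?_⟩
    exact mul_self_pos.mpr (by simpa [p] using hi)
  have G_nonneg : 0 ≤ G α α := by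
    rw [G_apply]
    exact Finset.sum_nonneg fun g _ => mul_self_nonneg _
  have key (c : W) (γ : B →₀ ℝ) (hγ : coxeterForm M γ γ = 1)
      (hc : ∀ v, geomRep cs hcrys c v = v - (2 * coxeterForm M v γ) • γ) (v : B →₀ ℝ) :
      G v γ = coxeterForm M v γ * G γ γ := by
    have h := G_inv c v γ
    rw [hc, hc γ, hγ] at h
    simp only [map_sub, map_smul, LinearMap.sub_apply, LinearMap.smul_apply, smul_eq_mul] at h
    linarith
  have h1 := key a α hα ha β
  have h2 := key b β hβ hb α
  rw [G_comm β α, coxeterForm_comm M β α] at h1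
  simp only [map_sub, map_smul, LinearMap.sub_apply, LinearMap.smul_apply, smul_eq_mul,
    G_comm β α] at G_pos
  rw [← h2, h1, sub_self, mul_zero, sub_zero] at G_pos
  by_contra hcon
  have := mul_nonneg (sub_nonneg.mpr (not_lt.mp hcon)) G_nonneg
  linarith

end GeomRep

/-- The geometric representation of a finite Weyl group provides a reflection model. -/
theorem nonempty_reflectionModel {B W : Type*} [Group W] [Finite W] {M : CoxeterMatrix B}
    (cs : CoxeterSystem M W) (hcrys : ∀ i j : B, i ≠ j → M i j ∈ ({2, 3, 4, 6} : Set ℕ)) :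
    Nonempty (ReflectionModel cs (B →₀ ℝ)) := by
  have hex (t : W) : ∃ α : B →₀ ℝ, cs.IsReflection t → ∃ w i, t = w * cs.simple i * w⁻¹ ∧
      α = geomRep cs hcrys w (Finsupp.single i 1) ∧ 0 < coordSum B α := by
    by_cases ht : cs.IsReflection t
    · obtain ⟨w, i, h1, h2⟩ := exists_conj_simple_of_isReflection cs hcrys ht
      exact ⟨_, fun _ => ⟨w, i, h1, rfl, h2⟩⟩
    · exact ⟨0, fun h => absurd h ht⟩
  choose root hroot using hex
  have form_root {t : W} (ht : cs.IsReflection t) :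
      coxeterForm M (root t) (root t) = 1 := by
    obtain ⟨w, i, -, h, -⟩ := hroot t ht
    rw [h, coxeterForm_geomRep_single]
  have ht_root {t : W} (ht : cs.IsReflection t) : 0 < coordSum B (root t) := by
    obtain ⟨w, i, -, -, h⟩ := hroot t ht
    exact h
  have act_reflection {t : W} (ht : cs.IsReflection t) (v : B →₀ ℝ) :
      geomRep cs hcrys t v = v - (2 * coxeterForm M v (root t)) • root t := by
    obtain ⟨w, i, h, h', -⟩ := hroot t ht
    rw [h', ← geomRep_conj_simple, ← h]
  have root_inj {a b : W} (ha : cs.IsReflection a) (hb : cs.IsReflection b)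
      (h : root a = root b) : a = b :=
    geomRep_injective cs hcrys <| LinearMap.ext fun v => by
      rw [act_reflection ha, act_reflection hb, h]
  refine ⟨{
    act := geomRep cs hcrys
    form := coxeterForm M
    ht := coordSum B
    root := root
    form_comm := coxeterForm_comm M
    form_act := coxeterForm_geomRep cs hcrys
    form_root := form_root
    act_reflection := act_reflection
    ht_root := ht_root
    root_injective := root_inj
    length_lt_iff := fun {t} ht w => ?_
    form_sq_lt_one := fun {a b} ha hb hne => ?_ }⟩
  · obtain ⟨g, i, h, h', hpos⟩ := hroot t ht
    rw [h'] at hpos ⊢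
    rw [h, length_lt_mul_conj_simple_iff cs hcrys hpos]
  · refine coxeterForm_sq_lt_one cs hcrys (form_root ha) (form_root hb) (act_reflection ha)
      (act_reflection hb) fun h0 => hne (root_inj ha hb ?_)
    rw [sub_eq_zero] at h0
    generalize coxeterForm M (root a) (root b) = c at h0
    have h1 := form_root ha
    have h2 := ht_root ha
    rw [h0] at h1 h2
    simp only [map_smul, LinearMap.smul_apply, form_root hb, smul_eq_mul] at h1 h2
    have h3 := ht_root hb
    have h4 : c = 1 := by
      have : 0 < c := pos_of_mul_pos_left h2 h3.le
      nlinarith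
    rw [h0, h4, one_smul]

/-! ### Reflections whose roots lie in a common plane -/

namespace ReflectionModel

variable {B W : Type*} [Group W] {M : CoxeterMatrix B} {cs : CoxeterSystem M W}
  {V : Type*} [AddCommGroup V] [Module ℝ V] (R : ReflectionModel cs V)

theorem act_mul (g h : W) (v : V) : R.act (g * h) v = R.act g (R.act h v) := by
  rw [map_mul, Module.End.mul_apply]

theorem act_inv_act (g : W) (v : V) : R.act g⁻¹ (R.act g v) = v := by
  rw [← R.act_mul, inv_mul_cancel, map_one, Module.End.one_apply]

theorem act_root_self {t : W} (ht : cs.IsReflection t) : R.act t (R.root t) = -R.root t := by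
  rw [R.act_reflection ht, R.form_root ht]
  module

theorem act_root_eq {t : W} (ht : cs.IsReflection t) (g : W) :
    R.act g (R.root t) = R.root (g * t * g⁻¹) ∨ R.act g (R.root t) = -R.root (g * t * g⁻¹) := by
  have h1 := R.act_mul (g * t) g⁻¹ (R.act g (R.root t))
  rw [R.act_inv_act, R.act_mul g t, R.act_root_self ht, R.act_reflection (ht.conj g), map_neg] at h1
  have h2 := R.form_act g (R.root t) (R.root t)
  rw [R.form_root ht] at h2
  generalize R.act g (R.root t) = u at *
  generalize hc : R.form u (R.root (g * t * g⁻¹)) = c at *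
  have h3 : u = c • R.root (g * t * g⁻¹) := by
    have : (2 : ℝ) • u = (2 : ℝ) • (c • R.root (g * t * g⁻¹)) := by
      linear_combination (norm := module) h1
    exact smul_right_injective V (two_ne_zero' ℝ) this
  rw [h3] at h2
  simp only [map_smul, LinearMap.smul_apply, R.form_root (ht.conj g), smul_eq_mul, mul_one] at h2
  rcases mul_self_eq_one_iff.mp h2 with h | h
  · left
    rw [h3, h, one_smul]
  · right
    rw [h3, h, neg_one_smul]

theorem ht_root_conj {t : W} (ht : cs.IsReflection t) (g : W) :
    R.ht (R.root (g * t * g⁻¹)) = |R.ht (R.act g (R.root t))| := by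
  have := R.ht_root (ht.conj g)
  rcases R.act_root_eq ht g with h | h
  · rw [h, abs_of_pos this]
  · rw [h, map_neg, abs_neg, abs_of_pos this]

theorem ht_act_root_ne_zero {t : W} (ht : cs.IsReflection t) (g : W) :
    R.ht (R.act g (R.root t)) ≠ 0 := by
  have := R.ht_root (ht.conj g)
  rw [R.ht_root_conj ht] at this
  exact abs_pos.mp this

theorem length_lt_mul_left_iff {t : W} (ht : cs.IsReflection t) (w : W) :
    cs.length w < cs.length (t * w) ↔ 0 < R.ht (R.act w⁻¹ (R.root t)) := by
  rw [← R.length_lt_iff ht, ← cs.length_inv w, ← cs.length_inv (t * w), mul_inv_rev, ht.inv]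

/-- Roots of distinct reflections are linearly independent. -/
theorem root_independent {a b : W} (ha : cs.IsReflection a) (hb : cs.IsReflection b) (hne : a ≠ b)
    {x y : ℝ} (h : x • R.root a + y • R.root b = 0) : x = 0 ∧ y = 0 := by
  have h1 := congrArg (fun v => R.form v (R.root a)) h
  have h2 := congrArg (fun v => R.form v (R.root b)) h
  simp only [map_add, map_smul, LinearMap.add_apply, LinearMap.smul_apply, R.form_root ha,
    R.form_root hb, smul_eq_mul, map_zero, LinearMap.zero_apply,
    R.form_comm (R.root b) (R.root a)] at h1 h2
  have h3 := R.form_sq_lt_one ha hb hne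
  generalize R.form (R.root a) (R.root b) = c at *
  have hx : (1 - c ^ 2) * x = 0 := by linear_combination h1 - c * h2
  have hy : (1 - c ^ 2) * y = 0 := by linear_combination h2 - c * h1
  have hc : 1 - c ^ 2 ≠ 0 := by linarith
  exact ⟨(mul_eq_zero.mp hx).resolve_left hc, (mul_eq_zero.mp hy).resolve_left hc⟩

/-- A plane is spanned by the roots of any two distinct reflections it contains. -/
theorem span_root_pair {a b : W} (ha : cs.IsReflection a) (hb : cs.IsReflection b) (hne : a ≠ b)
    {v₁ v₂ : V} (ha' : R.root a ∈ Submodule.span ℝ {v₁, v₂})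
    (hb' : R.root b ∈ Submodule.span ℝ {v₁, v₂}) :
    Submodule.span ℝ {R.root a, R.root b} = Submodule.span ℝ {v₁, v₂} := by
  apply le_antisymm
  · rw [Submodule.span_le]
    rintro v (rfl | rfl)
    exacts [ha', hb']
  · obtain ⟨a₁, a₂, hα⟩ := Submodule.mem_span_pair.mp ha'
    obtain ⟨b₁, b₂, hβ⟩ := Submodule.mem_span_pair.mp hb'
    have e1 : (a₁ * b₂ - a₂ * b₁) • v₁ = b₂ • R.root a + (-a₂) • R.root b := by
      rw [← hα, ← hβ]
      module
    have e2 : (a₁ * b₂ - a₂ * b₁) • v₂ = (-b₁) • R.root a + a₁ • R.root b := by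
      rw [← hα, ← hβ]
      module
    have hdet : a₁ * b₂ - a₂ * b₁ ≠ 0 := by
      intro h0
      rw [h0, zero_smul] at e1 e2
      have h1 := R.root_independent ha hb hne e1.symm
      have h2 := R.root_independent ha hb hne e2.symm
      have h3 : R.root b = 0 := by
        rw [← hβ, h1.1, neg_eq_zero.mp h2.1, zero_smul, zero_smul, add_zero]
      simpa [h3] using R.ht_root hb
    rw [Submodule.span_le]
    rintro v (rfl | rfl)
    · rw [SetLike.mem_coe, ← Submodule.smul_mem_iff _ hdet, e1]
      exact Submodule.mem_span_pair.mpr ⟨_, _, rfl⟩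
    · rw [SetLike.mem_coe, ← Submodule.smul_mem_iff _ hdet, e2]
      exact Submodule.mem_span_pair.mpr ⟨_, _, rfl⟩

/-- The reflections whose root lies in the subspace `P`. -/
def reflections (P : Submodule ℝ V) : Set W := {q | cs.IsReflection q ∧ R.root q ∈ P}

variable {R} {P : Submodule ℝ V}

theorem act_sub_mem {q : W} (hq : q ∈ R.reflections P) (v : V) : R.act q v - v ∈ P := by
  rw [R.act_reflection hq.1, sub_sub_cancel_left]
  exact P.neg_mem (P.smul_mem _ hq.2)

theorem act_mul_sub_mem {g h : W} (hg : ∀ v, R.act g v - v ∈ P) (hh : ∀ v, R.act h v - v ∈ P)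
    (v : V) : R.act (g * h) v - v ∈ P := by
  rw [R.act_mul, ← sub_add_sub_cancel]
  exact P.add_mem (hg _) (hh v)

theorem mem_reflections_of_act_sub_mem {t : W} (ht : cs.IsReflection t)
    (h : ∀ v, R.act t v - v ∈ P) : t ∈ R.reflections P := by
  refine ⟨ht, ?_⟩
  have := h (R.root t)
  rw [R.act_root_self ht] at this
  have h2 : (-2 : ℝ) • R.root t ∈ P := by
    convert this using 1
    module
  exact (P.smul_mem_iff (by norm_num)).mp h2

theorem conj_mem_reflections {a q : W} (ha : a ∈ R.reflections P) (hq : q ∈ R.reflections P) :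
    a * q * a⁻¹ ∈ R.reflections P := by
  refine mem_reflections_of_act_sub_mem (hq.1.conj a)
    (act_mul_sub_mem (act_mul_sub_mem (act_sub_mem ha) (act_sub_mem hq)) ?_)
  rw [ha.1.inv]
  exact act_sub_mem ha

/-- The product of three reflections with coplanar roots is a reflection. -/
theorem mul_mul_mem_reflections [Finite W] {v₁ v₂ : V} (hP : P = Submodule.span ℝ {v₁, v₂})
    {a b c : W} (ha : a ∈ R.reflections P) (hb : b ∈ R.reflections P)
    (hc : c ∈ R.reflections P) : a * b * c ∈ R.reflections P := by
  refine mem_reflections_of_act_sub_mem ?_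
    (act_mul_sub_mem (act_mul_sub_mem (act_sub_mem ha) (act_sub_mem hb)) (act_sub_mem hc))
  by_contra hbad
  let S : Set (W × W × W) := {p | p.1 ∈ R.reflections P ∧ p.2.1 ∈ R.reflections P ∧
    p.2.2 ∈ R.reflections P ∧ ¬cs.IsReflection (p.1 * p.2.1 * p.2.2)}
  obtain ⟨⟨a, b, c⟩, hS, hmin⟩ := Set.exists_min_image S
    (fun p => R.ht (R.root p.1) + R.ht (R.root p.2.1) + R.ht (R.root p.2.2)) (Set.toFinite S)
    ⟨(a, b, c), ha, hb, hc, hbad⟩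
  clear ha hb hc hbad
  have rot {a b c : W} (h : (a, b, c) ∈ S) : (b, c, a) ∈ S := by
    obtain ⟨ha, hb, hc, hbad⟩ := h
    refine ⟨hb, hc, ha, fun h => hbad ?_⟩
    have := h.conj a
    simpa [mul_assoc] using this
  have drop {a b : W} (ha : cs.IsReflection a) (hb : cs.IsReflection b) (hne : a ≠ b)
      (hpos : 0 < R.form (R.root b) (R.root a)) (hle : R.ht (R.root a) ≤ R.ht (R.root b)) :
      R.ht (R.root (a * b * a⁻¹)) < R.ht (R.root b) := by
    have h1 := R.form_sq_lt_one hb ha hne.symm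
    have h2 := R.ht_root ha
    have h3 := R.ht_root hb
    rw [R.ht_root_conj hb, R.act_reflection ha, map_sub, map_smul, smul_eq_mul, abs_lt]
    have h4 : R.form (R.root b) (R.root a) < 1 := by nlinarith
    constructor <;> nlinarith
  have key {a b c : W} (h : (a, b, c) ∈ S)
      (hm : ∀ p ∈ S, R.ht (R.root a) + R.ht (R.root b) + R.ht (R.root c) ≤
        R.ht (R.root p.1) + R.ht (R.root p.2.1) + R.ht (R.root p.2.2)) :
      R.form (R.root b) (R.root c) ≤ 0 := by
    by_contra! hpos
    obtain ⟨ha, hb, hc, hbad⟩ := h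
    have hne : b ≠ c := by
      rintro rfl
      rw [mul_assoc, hb.1.mul_self, mul_one] at hbad
      exact hbad ha.1
    rcases le_total (R.ht (R.root c)) (R.ht (R.root b)) with hle | hle
    · have h1 := drop hc.1 hb.1 hne.symm hpos hle
      have h2 := hm (a, c, c * b * c⁻¹) ⟨ha, hc, conj_mem_reflections hc hb, by
        convert hbad using 2
        simp only [mul_assoc, hc.1.inv]
        rw [← mul_assoc c c, hc.1.mul_self, one_mul]⟩
      simp only at h2
      linarith
    · rw [R.form_comm] at hpos
      have h1 := drop hb.1 hc.1 hne hpos hle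
      have h2 := hm (a, b * c * b⁻¹, b) ⟨ha, conj_mem_reflections hb hc, hb, by
        convert hbad using 2
        simp [mul_assoc]⟩
      simp only at h2
      linarith
  have hbc := key hS hmin
  have hca := key (rot hS) fun p hp => by
    have := hmin p hp
    simp only at this
    linarith
  have hab := key (rot (rot hS)) fun p hp => by
    have := hmin p hp
    simp only at this
    linarith
  obtain ⟨ha, hb, hc, -⟩ := hS
  simp only at ha hb hc
  have hne : a ≠ b := by
    rintro rfl
    rw [R.form_root ha.1] at hab
    linarith
  have hmem := hc.2
  rw [hP, ← R.span_root_pair ha.1 hb.1 hne (hP ▸ ha.2) (hP ▸ hb.2)] at hmem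
  obtain ⟨x, y, hxy⟩ := Submodule.mem_span_pair.mp hmem
  have h1 := R.form_sq_lt_one ha.1 hb.1 hne
  have h2 := R.ht_root ha.1
  have h3 := R.ht_root hb.1
  have h4 := R.ht_root hc.1
  rw [← hxy] at hbc hca h4
  rw [R.form_comm] at hbc
  simp only [map_add, map_smul, LinearMap.add_apply, LinearMap.smul_apply, R.form_root ha.1,
    R.form_root hb.1, smul_eq_mul, R.form_comm (R.root b) (R.root a)] at hbc hca h4
  generalize R.form (R.root a) (R.root b) = d at *
  have hx : x ≤ 0 := by
    by_contra! hx
    have e1 : x * (1 - d ^ 2) ≤ 0 := by nlinarith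
    nlinarith
  have hy : y ≤ 0 := by
    by_contra! hy
    have e1 : y * (1 - d ^ 2) ≤ 0 := by nlinarith
    nlinarith
  nlinarith

/-- If a product of two distinct reflections equals a product of two reflections with roots in a
subspace, then the roots of the former lie in that subspace as well. -/
theorem left_mem_reflections_of_mul_eq {q r q' r' : W} (hq : q ∈ R.reflections P)
    (hr : r ∈ R.reflections P) (hq' : cs.IsReflection q') (hr' : cs.IsReflection r')
    (hne : q' ≠ r') (h : q * r = q' * r') : q' ∈ R.reflections P := by
  refine ⟨hq', ?_⟩
  have h1 := act_mul_sub_mem (act_sub_mem hq) (act_sub_mem hr)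
    (R.root q' - R.form (R.root q') (R.root r') • R.root r')
  have h2 := R.form_sq_lt_one hq' hr' hne
  rw [h, R.act_mul, R.act_reflection hq', R.act_reflection hr'] at h1
  simp only [map_sub, map_smul, LinearMap.sub_apply, LinearMap.smul_apply, R.form_root hq',
    R.form_root hr', smul_eq_mul, R.form_comm (R.root r') (R.root q')] at h1
  generalize R.form (R.root q') (R.root r') = c at *
  have h3 : (-2 * (1 - c ^ 2)) • R.root q' ∈ P := by
    convert h1 using 1
    module
  exact (P.smul_mem_iff (by nlinarith)).mp h3

theorem right_mem_reflections_of_mul_eq {q r q' r' : W} (hq : q ∈ R.reflections P)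
    (hr : r ∈ R.reflections P) (hq' : cs.IsReflection q') (hr' : cs.IsReflection r')
    (hne : q' ≠ r') (h : q * r = q' * r') : r' ∈ R.reflections P := by
  refine left_mem_reflections_of_mul_eq hr hq hr' hq' hne.symm ?_
  have := congrArg (·⁻¹) h
  simpa only [mul_inv_rev, hq.1.inv, hr.1.inv, hq'.inv, hr'.inv] using this

variable (R) in
theorem mem_reflections_span_left {a : W} (ha : cs.IsReflection a) (v : V) :
    a ∈ R.reflections (Submodule.span ℝ {R.root a, v}) :=
  ⟨ha, Submodule.subset_span (Set.mem_insert _ _)⟩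

variable (R) in
theorem mem_reflections_span_right {a : W} (ha : cs.IsReflection a) (v : V) :
    a ∈ R.reflections (Submodule.span ℝ {v, R.root a}) :=
  ⟨ha, Submodule.subset_span (Set.mem_insert_of_mem _ rfl)⟩

end ReflectionModel

/-! ### The Bruhat graph -/

/-- Adjacency in the Bruhat graph. -/
def BruhatAdj {B W : Type*} [Group W] {M : CoxeterMatrix B} (cs : CoxeterSystem M W) (x y : W) :
    Prop :=
  cs.IsReflection (y * x⁻¹)

section BruhatGraph

variable {B W : Type*} [Group W] {M : CoxeterMatrix B} {cs : CoxeterSystem M W}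

theorem BruhatAdj.symm {x y : W} (h : BruhatAdj cs x y) : BruhatAdj cs y x := by
  have := h.isReflection_inv
  simpa [BruhatAdj] using this

theorem bruhatAdj_iff_isReflection_inv_mul {x y : W} :
    BruhatAdj cs x y ↔ cs.IsReflection (x⁻¹ * y) := by
  rw [BruhatAdj, ← cs.isReflection_conj_iff x⁻¹ (y * x⁻¹)]
  simp [mul_assoc]

theorem bruhatAdj_mul {q : W} (hq : cs.IsReflection q) (x : W) : BruhatAdj cs x (q * x) := by
  simpa [BruhatAdj] using hq

/-- Two vertices with two common neighbours, both adjacent to two of three common neighbours of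
another pair of vertices, are adjacent. -/
theorem bruhatAdj_of_adj [Finite W] {V : Type*} [AddCommGroup V] [Module ℝ V]
    (R : ReflectionModel cs V) {x y a a' b b' : W} (hb : b ≠ b') (ha : a ≠ a') (hxb : x ≠ b)
    (hxa : BruhatAdj cs x a) (hxa' : BruhatAdj cs x a') (hab : BruhatAdj cs a b)
    (hab' : BruhatAdj cs a b') (ha'b : BruhatAdj cs a' b) (ha'b' : BruhatAdj cs a' b')
    (hby : BruhatAdj cs b y) (hb'y : BruhatAdj cs b' y) : BruhatAdj cs x y := by
  have cancel (u v w : W) : u * v⁻¹ * (v * w⁻¹) = u * w⁻¹ := by simp [mul_assoc]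
  have ne {u v w : W} (h : u ≠ w) (hv : BruhatAdj cs v w) : u * v⁻¹ ≠ v * w⁻¹ := by
    intro h'
    have h1 := cancel u v w
    rw [h', hv.symm.mul_self] at h1
    exact h (mul_inv_eq_one.mp h1.symm)
  set P := Submodule.span ℝ {R.root (b' * a⁻¹), R.root (a * b⁻¹)} with hP
  have h1 : b' * a⁻¹ ∈ R.reflections P := R.mem_reflections_span_left hab' _
  have h2 : a * b⁻¹ ∈ R.reflections P := R.mem_reflections_span_right hab.symm _
  have h3 : a' * b⁻¹ ∈ R.reflections P :=
    ReflectionModel.right_mem_reflections_of_mul_eq h1 h2 ha'b' ha'b.symm (ne hb.symm ha'b)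
      (by rw [cancel, cancel])
  have h4 : y * b⁻¹ ∈ R.reflections P :=
    ReflectionModel.right_mem_reflections_of_mul_eq h1 h2 hb'y.symm hby (ne hb.symm hby.symm)
      (by rw [cancel, cancel])
  have h5 : x * a⁻¹ ∈ R.reflections P := by
    have h6 := R.mem_reflections_span_left hxa.symm (R.root (a * b⁻¹))
    have h7 := R.mem_reflections_span_right hab.symm (R.root (x * a⁻¹))
    have h8 := ReflectionModel.right_mem_reflections_of_mul_eq h6 h7 hxa'.symm ha'b.symm
      (ne hxb ha'b) (by rw [cancel, cancel])
    have h9 : a * b⁻¹ ≠ a' * b⁻¹ := fun h => ha (mul_right_cancel h)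
    refine ⟨hxa.symm, ?_⟩
    have h10 := h6.2
    rw [← R.span_root_pair hab.symm ha'b.symm h9 h7.2 h8.2,
      R.span_root_pair hab.symm ha'b.symm h9 h2.2 h3.2] at h10
    exact h10
  have h11 := (ReflectionModel.mul_mul_mem_reflections hP h4 h2 h5).1
  have h12 : a * b⁻¹ = b * a⁻¹ := by rw [← hab.inv, mul_inv_rev, inv_inv]
  have h13 : x * a⁻¹ = a * x⁻¹ := by rw [← hxa.inv, mul_inv_rev, inv_inv]
  rwa [h12, h13, cancel, cancel] at h11

end BruhatGraph

/-! ### Chains of edges in a plane -/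

namespace ReflectionModel

variable {B W : Type*} [Group W] {M : CoxeterMatrix B} {cs : CoxeterSystem M W}
  {V : Type*} [AddCommGroup V] [Module ℝ V] (R : ReflectionModel cs V)

/-- The sign of the image of a root under a group element. -/
noncomputable def rootSign (g q : W) : ℤ := if 0 < R.ht (R.act g (R.root q)) then 1 else -1

theorem rootSign_mul {q : W} (hq : cs.IsReflection q) (h g : W) :
    R.rootSign (h * g) q = R.rootSign h (g * q * g⁻¹) * R.rootSign g q := by
  have h1 := R.ht_root (hq.conj g)
  have h2 := R.ht_act_root_ne_zero (hq.conj g) h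
  simp only [rootSign, R.act_mul]
  rcases R.act_root_eq hq g with h' | h' <;> rw [h']
  · simp [h1]
  · rcases lt_or_gt_of_ne h2 with h3 | h3
    · simp [h1.not_gt, h3, h3.not_gt]
    · simp [h1.not_gt, h3, h3.not_gt]

theorem rootSign_self {t : W} (ht : cs.IsReflection t) : R.rootSign t t = -1 := by
  have := R.ht_root ht
  rw [rootSign, R.act_root_self ht, map_neg, if_neg (by linarith)]

theorem rootSign_inv {t : W} (ht : cs.IsReflection t) (z : W) :
    R.rootSign z⁻¹ t = if cs.length (t * z) < cs.length z then -1 else 1 := by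
  have h1 := R.length_lt_mul_left_iff ht z
  have h2 := ht.length_mul_right_ne z
  simp only [rootSign, ← h1]
  split_ifs <;> first | rfl | omega

theorem rootSign_eq_one_of_commute {a q : W} (ha : cs.IsReflection a) (hq : cs.IsReflection q)
    (hne : q ≠ a) (h : a * q * a⁻¹ = q) : R.rootSign a q = 1 := by
  rw [rootSign, if_pos]
  rcases R.act_root_eq hq a with h' | h' <;> rw [h] at h'
  · rw [h']
    exact R.ht_root hq
  · rw [R.act_reflection ha] at h'
    have h1 : (2 : ℝ) • R.root q + (-(2 * R.form (R.root q) (R.root a))) • R.root a = 0 := by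
      linear_combination (norm := module) h'
    exact absurd (R.root_independent hq ha hne h1).1 two_ne_zero

variable {R} {P : Submodule ℝ V}

theorem conj_conj_self {a : W} (ha : cs.IsReflection a) (q : W) :
    a * (a * q * a⁻¹) * a⁻¹ = q := by
  rw [ha.inv]
  simp only [← mul_assoc, ha.mul_self, one_mul]
  rw [mul_assoc, ha.mul_self, mul_one]

section Finite

variable [Finite W]

variable (R P) in
/-- The finite set of reflections whose root lies in `P`. -/
noncomputable def reflectionFinset : Finset W := (Set.toFinite (R.reflections P)).toFinset

theorem mem_reflectionFinset {q : W} : q ∈ R.reflectionFinset P ↔ q ∈ R.reflections P := by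
  rw [reflectionFinset, Set.Finite.mem_toFinset]

theorem prod_rootSign_self {a : W} (ha : a ∈ R.reflections P) :
    ∏ q ∈ R.reflectionFinset P, R.rootSign a q = -1 := by
  classical
  rw [← Finset.mul_prod_erase _ _ (mem_reflectionFinset.mpr ha), R.rootSign_self ha.1]
  suffices ∏ q ∈ (R.reflectionFinset P).erase a, R.rootSign a q = 1 by rw [this, mul_one]
  refine Finset.prod_involution (fun q _ => a * q * a⁻¹) ?_ ?_ ?_ ?_
  · intro q hq
    have hq := mem_reflectionFinset.mp (Finset.mem_of_mem_erase hq)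
    rw [mul_comm, ← R.rootSign_mul hq.1, ha.1.mul_self, rootSign, map_one, Module.End.one_apply,
      if_pos (R.ht_root hq.1)]
  · intro q hq h1 h2
    exact h1 (R.rootSign_eq_one_of_commute ha.1
      (mem_reflectionFinset.mp (Finset.mem_of_mem_erase hq)).1 (Finset.ne_of_mem_erase hq) h2)
  · intro q hq
    have hq' := mem_reflectionFinset.mp (Finset.mem_of_mem_erase hq)
    refine Finset.mem_erase.mpr ⟨fun h => Finset.ne_of_mem_erase hq ?_,
      mem_reflectionFinset.mpr (conj_mem_reflections ha hq')⟩
    exact mul_inv_eq_one.mp (by simpa [mul_assoc] using h)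
  · intro q _
    exact conj_conj_self ha.1 q

theorem prod_rootSign_mul {a : W} (ha : a ∈ R.reflections P) (g : W) :
    ∏ q ∈ R.reflectionFinset P, R.rootSign (g * a) q =
      -∏ q ∈ R.reflectionFinset P, R.rootSign g q := by
  rw [Finset.prod_congr rfl fun q hq => R.rootSign_mul (mem_reflectionFinset.mp hq).1 g a,
    Finset.prod_mul_distrib, prod_rootSign_self ha, mul_neg_one]
  congr 1
  refine Finset.prod_nbij' (fun q => a * q * a⁻¹) (fun q => a * q * a⁻¹) ?_ ?_ ?_ ?_ ?_
  · exact fun q hq => mem_reflectionFinset.mpr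
      (conj_mem_reflections ha (mem_reflectionFinset.mp hq))
  · exact fun q hq => mem_reflectionFinset.mpr
      (conj_mem_reflections ha (mem_reflectionFinset.mp hq))
  · exact fun q _ => conj_conj_self ha.1 q
  · exact fun q _ => conj_conj_self ha.1 q
  · exact fun q _ => rfl

theorem prod_rootSign_inv (z : W) :
    ∏ q ∈ R.reflectionFinset P, R.rootSign z⁻¹ q =
      (-1) ^ ((R.reflectionFinset P).filter fun q => cs.length (q * z) < cs.length z).card := by
  rw [Finset.prod_congr rfl fun q hq => R.rootSign_inv (mem_reflectionFinset.mp hq).1 z,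
    Finset.prod_ite, Finset.prod_const, Finset.prod_const_one, mul_one]

/-- Multiplying by two reflections of a plane preserves the parity of the number of inversions in
that plane. -/
theorem even_card_iff {a b : W} (ha : a ∈ R.reflections P) (hb : b ∈ R.reflections P) (z : W) :
    (Even ((R.reflectionFinset P).filter fun q =>
        cs.length (q * (a * b * z)) < cs.length (a * b * z)).card ↔
      Even ((R.reflectionFinset P).filter fun q => cs.length (q * z) < cs.length z).card) := by
  have h1 : ∏ q ∈ R.reflectionFinset P, R.rootSign (a * b * z)⁻¹ q =
      ∏ q ∈ R.reflectionFinset P, R.rootSign z⁻¹ q := by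
    rw [mul_inv_rev, mul_inv_rev, ha.1.inv, hb.1.inv, ← mul_assoc, prod_rootSign_mul ha,
      prod_rootSign_mul hb, neg_neg]
  rw [prod_rootSign_inv, prod_rootSign_inv] at h1
  rw [← neg_one_pow_eq_one_iff_even (R := ℤ) (by norm_num), h1,
    neg_one_pow_eq_one_iff_even (by norm_num)]

/-- Paths of length two in a plane come in pairs. -/
theorem exists_ne_between {v₁ v₂ : V} (hP : P = Submodule.span ℝ {v₁, v₂}) {a b q z : W}
    (ha : a ∈ R.reflections P) (hb : b ∈ R.reflections P) (hq : q ∈ R.reflections P)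
    (h1 : cs.length z < cs.length (q * z)) (h2 : cs.length (q * z) < cs.length (a * b * z)) :
    ∃ r ∈ R.reflections P, r ≠ q ∧ cs.length z < cs.length (r * z) ∧
      cs.length (r * z) < cs.length (a * b * z) := by
  classical
  set T := R.reflectionFinset P with hT
  set D := T.filter fun r => cs.length z < cs.length (r * z) ∧
    cs.length (r * z) < cs.length (a * b * z) with hD
  have hqD : q ∈ D := by
    simp only [hD, Finset.mem_filter]
    exact ⟨mem_reflectionFinset.mpr hq, h1, h2⟩
  have hcard : (T.filter fun r => cs.length (r * z) < cs.length z).card + D.card =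
      (T.filter fun r => cs.length (r * z) < cs.length (a * b * z)).card := by
    rw [← Finset.card_union_of_disjoint]
    · congr 1
      ext r
      simp only [hD, Finset.mem_union, Finset.mem_filter]
      constructor
      · rintro (⟨h, h'⟩ | ⟨h, h'⟩)
        · exact ⟨h, by omega⟩
        · exact ⟨h, h'.2⟩
      · rintro ⟨h, h'⟩
        have := (mem_reflectionFinset.mp h).1.length_mul_right_ne z
        rcases lt_or_gt_of_ne this with h3 | h3
        · exact Or.inl ⟨h, h3⟩
        · exact Or.inr ⟨h, h3, h'⟩
    · rw [Finset.disjoint_filter]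
      intro r _ h h'
      omega
  have hbij : (T.filter fun r => cs.length (r * z) < cs.length (a * b * z)).card =
      (T.filter fun r => cs.length (r * (a * b * z)) < cs.length (a * b * z)).card := by
    refine Finset.card_nbij' (fun r => r * b * a) (fun r => r * a * b) ?_ ?_ ?_ ?_
    · intro r hr
      simp only [Finset.coe_filter, Set.mem_ofPred_eq] at hr ⊢
      refine ⟨mem_reflectionFinset.mpr
        (mul_mul_mem_reflections hP (mem_reflectionFinset.mp hr.1) hb ha), ?_⟩
      convert hr.2 using 2
      calc r * b * a * (a * b * z) = r * (b * (a * a) * b) * z := by group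
        _ = r * z := by rw [ha.1.mul_self, mul_one, hb.1.mul_self, mul_one]
    · intro r hr
      simp only [Finset.coe_filter, Set.mem_ofPred_eq] at hr ⊢
      refine ⟨mem_reflectionFinset.mpr
        (mul_mul_mem_reflections hP (mem_reflectionFinset.mp hr.1) ha hb), ?_⟩
      convert hr.2 using 2
      group
    · intro r _
      calc r * b * a * a * b = r * (b * (a * a) * b) := by group
        _ = r := by rw [ha.1.mul_self, mul_one, hb.1.mul_self, mul_one]
    · intro r _
      calc r * a * b * b * a = r * (a * (b * b) * a) := by group
        _ = r := by rw [hb.1.mul_self, mul_one, ha.1.mul_self, mul_one]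
  have heven : Even D.card := by
    have := even_card_iff ha hb z
    rw [← hT, ← hbij, ← hcard, Nat.even_add] at this
    tauto
  have hlt : 1 < D.card := by
    have : D.card ≠ 1 := fun h => by simp [h] at heven
    have : 0 < D.card := Finset.card_pos.mpr ⟨q, hqD⟩
    omega
  obtain ⟨r, hrD, hne⟩ := Finset.exists_mem_ne hlt q
  simp only [hD, Finset.mem_filter] at hrD
  exact ⟨r, mem_reflectionFinset.mp hrD.1, hne, hrD.2⟩

end Finite

variable (R) in
theorem act_simple_root {q : W} (hq : cs.IsReflection q) {i : B} (hne : q ≠ cs.simple i) :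
    R.act (cs.simple i) (R.root q) = R.root (cs.simple i * q * (cs.simple i)⁻¹) := by
  have h1 : cs.length (cs.simple i) < cs.length (cs.simple i * q) := by
    have h1 := hq.length_mul_left_ne (cs.simple i)
    have h2 : cs.length (cs.simple i * q) ≠ 0 := by
      rw [Ne, cs.length_eq_zero_iff]
      intro h
      have := eq_inv_of_mul_eq_one_right h
      exact hne (by rw [this, cs.inv_simple])
    rw [cs.length_simple] at h1 ⊢
    omega
  rw [R.length_lt_iff hq] at h1
  rcases R.act_root_eq hq (cs.simple i) with h | h
  · exact h
  · have := R.ht_root (hq.conj (cs.simple i))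
    rw [h, map_neg] at h1
    linarith

/-- Left multiplication by a simple reflection preserves the direction of the edges of the Bruhat
graph with any other label. -/
theorem length_simple_mul_lt (R : ReflectionModel cs V) {q : W} (hq : cs.IsReflection q)
    {i : B} (hne : q ≠ cs.simple i) {z : W} (hz : cs.length z < cs.length (q * z)) :
    cs.length (cs.simple i * z) < cs.length (cs.simple i * (q * z)) := by
  have h : cs.simple i * (q * z) = cs.simple i * q * (cs.simple i)⁻¹ * (cs.simple i * z) := by
    group
  rw [h, R.length_lt_mul_left_iff (hq.conj _), ← R.act_simple_root hq hne, ← R.act_mul]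
  rw [R.length_lt_mul_left_iff hq] at hz
  simpa [mul_assoc] using hz

theorem simple_conj_mem_reflections {q : W} {i : B} {v₁ v₂ : V} (hne : q ≠ cs.simple i)
    (hq : q ∈ R.reflections (Submodule.span ℝ {v₁, v₂})) :
    cs.simple i * q * (cs.simple i)⁻¹ ∈ R.reflections
      (Submodule.span ℝ {R.act (cs.simple i) v₁, R.act (cs.simple i) v₂}) := by
  refine ⟨hq.1.conj _, ?_⟩
  rw [← R.act_simple_root hq.1 hne]
  obtain ⟨a, b, h⟩ := Submodule.mem_span_pair.mp hq.2
  rw [← h, map_add, map_smul, map_smul]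
  exact Submodule.mem_span_pair.mpr ⟨a, b, rfl⟩

variable (R) in
/-- An edge of the Bruhat graph of length at least three is refined by a path of length three with
coplanar roots. -/
theorem exists_path {t : W} (ht : cs.IsReflection t) {x : W}
    (hx : cs.length x + 3 ≤ cs.length (t * x)) :
    ∃ v₁ v₂ : V, ∃ q₀ ∈ R.reflections (Submodule.span ℝ {v₁, v₂}),
      ∃ q₁ ∈ R.reflections (Submodule.span ℝ {v₁, v₂}),
      ∃ q₂ ∈ R.reflections (Submodule.span ℝ {v₁, v₂}),
        q₂ * q₁ * q₀ = t ∧ cs.length x < cs.length (q₀ * x) ∧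
          cs.length (q₀ * x) < cs.length (q₁ * q₀ * x) ∧
            cs.length (q₁ * q₀ * x) < cs.length (t * x) := by
  induction hn : cs.length (t * x) using Nat.strong_induction_on generalizing t x with
  | _ n ih =>
  subst hn
  have hne : t * x ≠ 1 := by
    intro h
    simp [h] at hx
  obtain ⟨i, hi⟩ := cs.exists_leftDescent_of_ne_one hne
  rw [cs.isLeftDescent_iff] at hi
  have hs := cs.isReflection_simple i
  by_cases hts : t = cs.simple i
  · rw [hts, cs.simple_mul_simple_cancel_left] at hi
    rw [hts] at hx
    omega
  rcases cs.length_simple_mul x i with hxi | hxi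
  · have h1 := R.mem_reflections_span_left hs (R.root t)
    have h2 := R.mem_reflections_span_right ht (R.root (cs.simple i))
    have e : cs.simple i * t * (cs.simple i)⁻¹ * cs.simple i * x = cs.simple i * (t * x) := by
      group
    refine ⟨_, _, cs.simple i, h1, _, conj_mem_reflections h1 h2, cs.simple i, h1, ?_, ?_⟩
    · rw [cs.inv_simple]
      simp [mul_assoc]
    · rw [e]
      omega
  · have e : cs.simple i * t * (cs.simple i)⁻¹ * (cs.simple i * x) = cs.simple i * (t * x) := by
      group
    obtain ⟨v₁, v₂, q₀, hq₀, q₁, hq₁, q₂, hq₂, hprod, hl₀, hl₁, hl₂⟩ :=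
      ih (cs.length (cs.simple i * (t * x))) (by omega) (ht.conj (cs.simple i))
        (x := cs.simple i * x) (by rw [e]; omega) (by rw [e])
    have hprod' : cs.simple i * (q₂ * q₁ * q₀) * cs.simple i = t := by
      rw [hprod, cs.inv_simple]
      simp [mul_assoc]
    by_cases h₂ : q₂ = cs.simple i
    · have : q₁ * q₀ * (cs.simple i * x) = t * x := by
        rw [← hprod', h₂]
        simp [mul_assoc]
      rw [this] at hl₂
      omega
    by_cases h₀ : q₀ = cs.simple i
    · rw [h₀] at hq₀ hprod' hl₀ hl₁ hl₂
      have e₁ : q₁ * cs.simple i * (cs.simple i * x) = q₁ * x := by simp [mul_assoc]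
      have e₂ : q₂ * q₁ * x = cs.simple i * (t * x) := by
        rw [← hprod']
        simp [mul_assoc]
      rw [e₁] at hl₁ hl₂
      rw [cs.simple_mul_simple_cancel_left] at hl₁
      refine ⟨v₁, v₂, q₁, hq₁, q₂, hq₂, _, hq₀, ?_, hl₁, ?_, ?_⟩
      · rw [← hprod']
        simp [mul_assoc]
      · rwa [e₂]
      · rw [e₂]
        omega
    by_cases h₁ : q₁ = cs.simple i
    · rw [h₁] at hq₁ hprod' hl₁ hl₂
      have hc := conj_mem_reflections hq₁ hq₀
      have e₁ : cs.simple i * q₀ * (cs.simple i * x) =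
          cs.simple i * q₀ * (cs.simple i)⁻¹ * x := by
        rw [cs.inv_simple]
        group
      have e₂ : q₂ * (cs.simple i * q₀ * (cs.simple i)⁻¹) * x = cs.simple i * (t * x) := by
        rw [← hprod', cs.inv_simple]
        simp [mul_assoc]
      rw [e₁] at hl₁ hl₂
      refine ⟨v₁, v₂, _, hc, q₂, hq₂, _, hq₁, ?_, ?_, ?_, ?_⟩
      · rw [← hprod', cs.inv_simple]
        simp [mul_assoc]
      · omega
      · rwa [e₂]
      · rw [e₂]
        omega
    · refine ⟨_, _, _, simple_conj_mem_reflections h₀ hq₀, _, simple_conj_mem_reflections h₁ hq₁,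
        _, simple_conj_mem_reflections h₂ hq₂, ?_, ?_, ?_, ?_⟩
      · rw [← hprod', cs.inv_simple]
        simp [mul_assoc]
      · have := R.length_simple_mul_lt hq₀.1 h₀ hl₀
        rw [cs.simple_mul_simple_cancel_left] at this
        convert this using 2
        rw [cs.inv_simple]
        group
      · have := R.length_simple_mul_lt hq₁.1 h₁ (z := q₀ * (cs.simple i * x))
          (by rwa [← mul_assoc q₁ q₀])
        convert this using 2
        · rw [cs.inv_simple]
          group
        · rw [cs.inv_simple]
          simp [mul_assoc]
      · have e₂ : q₂ * (q₁ * q₀ * (cs.simple i * x)) = cs.simple i * (t * x) := by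
          rw [← hprod']
          simp [mul_assoc]
        have := R.length_simple_mul_lt hq₂.1 h₂ (z := q₁ * q₀ * (cs.simple i * x)) (by rwa [e₂])
        rw [e₂, cs.simple_mul_simple_cancel_left] at this
        convert this using 2
        rw [cs.inv_simple]
        simp [mul_assoc]

end ReflectionModel

/-! ### Special matchings and the Bruhat graph -/

section SpecialMatching

variable {B W : Type*} [Group W] {M : CoxeterMatrix B} {cs : CoxeterSystem M W}

theorem BruhatLE.mul_left {q : W} (hq : cs.IsReflection q) {x : W}
    (h : cs.length x < cs.length (q * x)) : BruhatLE cs x (q * x) :=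
  Relation.ReflTransGen.single ⟨q, hq, rfl, h⟩

theorem BruhatAdj.bruhatLE {x y : W} (h : BruhatAdj cs x y) (hlt : cs.length x < cs.length y) :
    BruhatLE cs x y :=
  Relation.ReflTransGen.single ⟨y * x⁻¹, h, by simp, hlt⟩

theorem BruhatAdj.length_lt_of_lt {x y : W} (h : BruhatAdj cs x y)
    (hlt : cs.length x < cs.length y) :
    cs.length y = cs.length x + 1 ∨ cs.length x + 3 ≤ cs.length y := by
  have h1 := h.odd_length
  have h2 := cs.length_mul_mod_two (y * x⁻¹) x
  rw [inv_mul_cancel_right] at h2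
  rw [Nat.odd_iff] at h1
  omega

theorem BruhatAdj.length_ne {x y : W} (h : BruhatAdj cs x y) : cs.length y ≠ cs.length x := by
  have := h.length_mul_right_ne x
  rwa [inv_mul_cancel_right] at this

theorem BruhatLE.bruhatAdj {x y : W} (h : BruhatLE cs x y) (hl : cs.length y = cs.length x + 1) :
    BruhatAdj cs x y := by
  rcases Relation.ReflTransGen.cases_head h with h' | ⟨c, ⟨t, ht, hc, hlt⟩, h'⟩
  · rw [h'] at hl
    omega
  · have hcy : c = y := by
      by_contra hne
      have := BruhatLE.length_lt h' hne
      omega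
    rw [← hcy, hc]
    exact bruhatAdj_mul ht x

theorem BruhatInterval.lt_length {u w : W} {x y : BruhatInterval cs u w} (h : x < y) :
    cs.length x.1 < cs.length y.1 :=
  BruhatLE.length_lt h.le fun h' => h.ne (Subtype.ext h')

theorem BruhatInterval.covBy_of_length {u w : W} {x y : BruhatInterval cs u w} (h : x ≤ y)
    (hl : cs.length y.1 = cs.length x.1 + 1) : x ⋖ y := by
  refine ⟨lt_of_le_of_ne h ?_, fun c hxc hcy => ?_⟩
  · rintro rfl
    omega
  · have h1 := BruhatInterval.lt_length hxc
    have h2 := BruhatInterval.lt_length hcy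
    omega

variable {V : Type*} [AddCommGroup V] [Module ℝ V]

theorem BruhatInterval.length_of_covBy (R : ReflectionModel cs V) {u w : W}
    {x y : BruhatInterval cs u w} (h : x ⋖ y) :
    cs.length y.1 = cs.length x.1 + 1 := by
  have hle : BruhatLE cs x.1 y.1 := h.1.le
  have mid {c : W} (h1 : BruhatLE cs x.1 c) (h2 : BruhatLE cs c y.1) (h3 : c ≠ x.1) : c = y.1 := by
    by_contra hne
    let c' : BruhatInterval cs u w := ⟨c, x.2.1.trans h1, h2.trans y.2.2⟩
    have h4 : x < c' := lt_of_le_of_ne h1 fun h => h3 (congrArg Subtype.val h).symm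
    have h5 : c' < y := lt_of_le_of_ne h2 fun h => hne (congrArg Subtype.val h)
    exact h.2 h4 h5
  rcases Relation.ReflTransGen.cases_head hle with h' | ⟨c, ⟨t, ht, hc, hlt⟩, h'⟩
  · exact absurd (Subtype.ext h') h.1.ne
  · have hcy : c = y.1 := mid (.single ⟨t, ht, hc, hlt⟩) h' (by rintro rfl; omega)
    rw [hcy] at hc hlt
    have hadj : BruhatAdj cs x.1 y.1 := by
      rw [hc]
      exact bruhatAdj_mul ht x.1
    rcases hadj.length_lt_of_lt hlt with h1 | h1
    · exact h1
    · rw [hc] at h1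
      obtain ⟨v₁, v₂, q₀, hq₀, q₁, hq₁, q₂, hq₂, rfl, hl₀, hl₁, hl₂⟩ := R.exists_path ht h1
      have e : q₂ * q₁ * q₀ * x.1 = q₂ * (q₁ * q₀ * x.1) := by group
      rw [mul_assoc q₁] at hl₁ hl₂ e
      have := mid (c := q₀ * x.1) (.mul_left hq₀.1 hl₀)
        ((BruhatLE.mul_left hq₁.1 hl₁).trans (by
          rw [hc, e]
          exact BruhatLE.mul_left hq₂.1 (by rwa [← e]))) (fun h => by rw [h] at hl₀; omega)
      rw [← hc, ← this] at hl₂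
      omega

theorem BruhatInterval.bruhatAdj_of_covBy (R : ReflectionModel cs V) {u w : W}
    {x y : BruhatInterval cs u w} (h : x ⋖ y) :
    BruhatAdj cs x.1 y.1 :=
  BruhatLE.bruhatAdj h.1.le (BruhatInterval.length_of_covBy R h)

/-- Special matchings map covering relations to edges of the Bruhat graph. -/
theorem IsSpecialMatching.bruhatAdj_of_covBy [Finite W] (R : ReflectionModel cs V) {u w : W}
    {f : BruhatInterval cs u w → BruhatInterval cs u w} (hf : IsSpecialMatching f)
    {x y : BruhatInterval cs u w} (h : x ⋖ y) : BruhatAdj cs (f x).1 (f y).1 := by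
  obtain ⟨⟨hinv, hmatch⟩, hspec⟩ := hf
  have hadj (z : BruhatInterval cs u w) : BruhatAdj cs z.1 (f z).1 := by
    rcases hmatch z with h | h
    · exact (BruhatInterval.bruhatAdj_of_covBy R h).symm
    · exact BruhatInterval.bruhatAdj_of_covBy R h
  have hxy := BruhatInterval.length_of_covBy R h
  rcases hspec x y h with h1 | h1
  · rw [h1, ← h1, hinv]
    exact (hadj x).symm
  have hl1 := BruhatInterval.lt_length h1
  rcases hmatch x with h2 | h2
  swap
  · have hl2 := BruhatInterval.length_of_covBy R h2
    refine BruhatLE.bruhatAdj h1.le ?_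
    rcases hmatch y with h3 | h3
    · have := BruhatInterval.length_of_covBy R h3
      omega
    · have := BruhatInterval.length_of_covBy R h3
      omega
  have hl2 := BruhatInterval.length_of_covBy R h2
  rcases hmatch y with h3 | h3
  · have := BruhatInterval.length_of_covBy R h3
    exact BruhatLE.bruhatAdj h1.le (by omega)
  have hl3 := BruhatInterval.length_of_covBy R h3
  have hr := (hadj x).symm
  have hr' := BruhatInterval.bruhatAdj_of_covBy R h
  have ex : x.1 * (f x).1⁻¹ * (f x).1 = x.1 := by group
  have ey : y.1 * x.1⁻¹ * (x.1 * (f x).1⁻¹) * (f x).1 = y.1 := by group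
  have m1 := R.mem_reflections_span_left hr' (R.root (x.1 * (f x).1⁻¹))
  have m2 := R.mem_reflections_span_right hr (R.root (y.1 * x.1⁻¹))
  obtain ⟨q, hq, hne, hq1, hq2⟩ := ReflectionModel.exists_ne_between rfl m1 m2 m2
    (z := (f x).1) (by rw [ex]; omega) (by rw [ex, ey]; omega)
  rw [ey] at hq2
  have haxy : BruhatAdj cs (q * (f x).1) y.1 := by
    have := (ReflectionModel.mul_mul_mem_reflections rfl m1 m2 hq).1
    rw [BruhatAdj]
    convert this using 1
    rw [mul_inv_rev, hq.1.inv]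
    group
  have hle1 : BruhatLE cs (f x).1 (q * (f x).1) := .mul_left hq.1 hq1
  have hle2 : BruhatLE cs (q * (f x).1) y.1 := haxy.bruhatLE hq2
  let a : BruhatInterval cs u w :=
    ⟨q * (f x).1, (f x).2.1.trans hle1, hle2.trans y.2.2⟩
  have ha : a.1 = q * (f x).1 := rfl
  rw [← ha] at hq1 hq2
  have hax : a ≠ x := by
    intro h
    apply hne
    exact eq_mul_inv_of_mul_eq (congrArg Subtype.val h)
  have c1 : f x ⋖ a := BruhatInterval.covBy_of_length hle1 (by omega)
  have c2 : a ⋖ y := BruhatInterval.covBy_of_length hle2 (by omega)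
  have l1 : x < f a := by
    rcases hspec _ _ c1 with h | h
    · rw [hinv] at h
      exact absurd h.symm hax
    · rwa [hinv] at h
  have hfay : f a ≠ y := by
    intro h
    have : a = f y := by rw [← h, hinv]
    rw [← this] at hl3
    omega
  have l2 : f a < f y := (hspec _ _ c2).resolve_left hfay
  have hl4 := BruhatInterval.lt_length l1
  have hl5 := BruhatInterval.lt_length l2
  refine bruhatAdj_of_adj R (a := x.1) (a' := a.1) (b := y.1) (b' := (f a).1) ?_ ?_ ?_ hr
    (BruhatInterval.bruhatAdj_of_covBy R c1) hr' (BruhatLE.bruhatAdj l1.le (by omega)) haxy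
    (hadj a) (hadj y) (BruhatLE.bruhatAdj l2.le (by omega))
  · exact fun h => hfay (Subtype.ext h.symm)
  · exact fun h => hax (Subtype.ext h.symm)
  · intro h
    rw [h] at hl2
    omega

/-- Special matchings preserve the edges of the Bruhat graph. -/
theorem IsSpecialMatching.bruhatAdj [Finite W] (R : ReflectionModel cs V) {u w : W}
    {f : BruhatInterval cs u w → BruhatInterval cs u w} (hf : IsSpecialMatching f)
    {x y : BruhatInterval cs u w} (h : BruhatAdj cs x.1 y.1) (hlt : cs.length x.1 < cs.length y.1) :
    BruhatAdj cs (f x).1 (f y).1 := by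
  induction hn : cs.length y.1 - cs.length x.1 using Nat.strong_induction_on generalizing x y with
  | _ n ih =>
  subst hn
  rcases h.length_lt_of_lt hlt with h1 | h1
  · exact hf.bruhatAdj_of_covBy R (BruhatInterval.covBy_of_length (h.bruhatLE hlt) h1)
  have ey : y.1 * x.1⁻¹ * x.1 = y.1 := by group
  obtain ⟨v₁, v₂, q₀, hq₀, q₁, hq₁, q₂, hq₂, hprod, hl₀, hl₁, hl₂⟩ :=
    R.exists_path h (x := x.1) (by rwa [ey])
  have ey' : q₂ * q₁ * (q₀ * x.1) = y.1 := by rw [← mul_assoc, hprod, ey]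
  rw [ey] at hl₂
  obtain ⟨p, hp, hpne, hp1, hp2⟩ :=
    ReflectionModel.exists_ne_between rfl hq₁ hq₀ hq₀ hl₀ hl₁
  obtain ⟨r, hr, hrne, hr1, hr2⟩ :=
    ReflectionModel.exists_ne_between rfl hq₂ hq₁ hq₁ (z := q₀ * x.1)
      (by rwa [← mul_assoc]) (by rwa [ey', ← mul_assoc])
  rw [ey'] at hr2
  have adj_pb : BruhatAdj cs (p * x.1) (q₁ * q₀ * x.1) := by
    have := (ReflectionModel.mul_mul_mem_reflections rfl hq₁ hq₀ hp).1
    rw [BruhatAdj]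
    convert this using 1
    rw [mul_inv_rev, hp.1.inv]
    group
  have adj_ry : BruhatAdj cs (r * (q₀ * x.1)) y.1 := by
    have := (ReflectionModel.mul_mul_mem_reflections rfl hq₂ hq₁ hr).1
    rw [BruhatAdj]
    convert this using 1
    rw [mul_inv_rev, hr.1.inv, ← ey']
    group
  have adj_pr : BruhatAdj cs (p * x.1) (r * (q₀ * x.1)) := by
    have := (ReflectionModel.mul_mul_mem_reflections rfl hr hq₀ hp).1
    rw [BruhatAdj]
    convert this using 1
    rw [mul_inv_rev, hp.1.inv]
    group
  have adj_by : BruhatAdj cs (q₁ * q₀ * x.1) y.1 := by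
    have := bruhatAdj_mul hq₂.1 (q₁ * q₀ * x.1)
    rw [← mul_assoc, ← mul_assoc, hprod, ey] at this
    exact this
  have adj_ab : BruhatAdj cs (q₀ * x.1) (q₁ * q₀ * x.1) := by
    rw [mul_assoc]
    exact bruhatAdj_mul hq₁.1 _
  have xa := BruhatLE.mul_left hq₀.1 hl₀
  have xp := BruhatLE.mul_left hp.1 hp1
  have ab := adj_ab.bruhatLE hl₁
  have by' := adj_by.bruhatLE hl₂
  have ar := BruhatLE.mul_left hr.1 hr1
  have ry := adj_ry.bruhatLE hr2
  have pb := adj_pb.bruhatLE hp2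
  let a : BruhatInterval cs u w := ⟨q₀ * x.1, x.2.1.trans xa, (ab.trans by').trans y.2.2⟩
  let a' : BruhatInterval cs u w := ⟨p * x.1, x.2.1.trans xp, (pb.trans by').trans y.2.2⟩
  let b : BruhatInterval cs u w :=
    ⟨q₁ * q₀ * x.1, (x.2.1.trans xa).trans ab, by'.trans y.2.2⟩
  let b' : BruhatInterval cs u w :=
    ⟨r * (q₀ * x.1), (x.2.1.trans xa).trans ar, ry.trans y.2.2⟩
  have inj {s t : BruhatInterval cs u w} (h : s.1 ≠ t.1) : (f s).1 ≠ (f t).1 := fun h' =>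
    h (congrArg Subtype.val (hf.1.1.injective (Subtype.ext h')))
  have step {s t : BruhatInterval cs u w} (hst : BruhatAdj cs s.1 t.1)
      (h1 : cs.length s.1 < cs.length t.1)
      (h2 : cs.length t.1 - cs.length s.1 < cs.length y.1 - cs.length x.1) :
      BruhatAdj cs (f s).1 (f t).1 := ih _ h2 hst h1 rfl
  have ha : a.1 = q₀ * x.1 := rfl
  have ha' : a'.1 = p * x.1 := rfl
  have hb : b.1 = q₁ * q₀ * x.1 := rfl
  have hb' : b'.1 = r * (q₀ * x.1) := rfl
  have adj_xa := bruhatAdj_mul hq₀.1 x.1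
  have adj_xp := bruhatAdj_mul hp.1 x.1
  have adj_ar := bruhatAdj_mul hr.1 (q₀ * x.1)
  have hab : a.1 ≠ a'.1 := fun h => hpne (mul_right_cancel h).symm
  have hbb : b.1 ≠ b'.1 := by
    intro h
    rw [hb, hb', mul_assoc] at h
    exact hrne (mul_right_cancel h).symm
  have hla := congrArg cs.length ha
  have hla' := congrArg cs.length ha'
  have hlb := congrArg cs.length hb
  have hlb' := congrArg cs.length hb'
  have step' {s t : BruhatInterval cs u w} (hst : BruhatAdj cs s.1 t.1)
      (h1 : cs.length x.1 < cs.length s.1 ∧ cs.length s.1 < cs.length y.1)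
      (h2 : cs.length x.1 < cs.length t.1 ∧ cs.length t.1 < cs.length y.1) :
      BruhatAdj cs (f s).1 (f t).1 := by
    rcases lt_trichotomy (cs.length s.1) (cs.length t.1) with h | h | h
    · exact step hst h (by omega)
    · exact absurd h.symm hst.length_ne
    · exact (step hst.symm h (by omega)).symm
  refine bruhatAdj_of_adj R (a := (f a).1) (a' := (f a').1) (b := (f b).1) (b' := (f b').1)
    (inj hbb) (inj hab) (inj ?_) (step adj_xa ?_ ?_) (step adj_xp ?_ ?_) (step' adj_ab ?_ ?_)
    (step' adj_ar ?_ ?_) (step' adj_pb ?_ ?_) (step' adj_pr ?_ ?_) (step adj_by ?_ ?_)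
    (step adj_ry ?_ ?_)
  · intro h
    have := congrArg cs.length h
    omega
  all_goals omega

end SpecialMatching

/-- A special matching of a Bruhat interval in a Weyl group maps edges of the
Bruhat graph to edges of the Bruhat graph: if `x⁻¹ * y` is a reflection, then so is
`M(x)⁻¹ * M(y)`. -/
theorem specialMatching_maps_reflections {B W : Type*} [Group W] [Finite W] {M : CoxeterMatrix B}
    (cs : CoxeterSystem M W)
    (hcrys : ∀ i j : B, i ≠ j → M i j ∈ ({2, 3, 4, 6} : Set ℕ))
    (u w : W) (huw : BruhatLE cs u w) (hne : u ≠ w)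
    (f : BruhatInterval cs u w → BruhatInterval cs u w) (hf : IsSpecialMatching f)
    (x y : BruhatInterval cs u w) (hxy : cs.IsReflection (x.1⁻¹ * y.1)) :
    cs.IsReflection ((f x).1⁻¹ * (f y).1) := by
  obtain ⟨R⟩ := nonempty_reflectionModel cs hcrys
  have h : BruhatAdj cs x.1 y.1 := bruhatAdj_iff_isReflection_inv_mul.mpr hxy
  rw [← bruhatAdj_iff_isReflection_inv_mul]
  rcases lt_or_gt_of_ne h.length_ne with hlt | hlt
  · exact (hf.bruhatAdj R h.symm hlt).symm
  · exact hf.bruhatAdj R h hlt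

end Paper
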